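/- Fix m ≥ 1, let δ ∈ (−1/(2cos((2m+2)π/(2m+3))), −1/(2cos(2mπ/(2m+1)))), and let k be an integer with 1 < k < m. Then I + δG(2k) is invertible, and with b(δ,2k) denoting the first entry of (I + δG(2k))⁻¹𝟙, one has δ·(b(δ,2k) + 1) < 1. In the notation of the paper, b(δ,1) + b(δ,2k) < 1/δ for 1 < k < m, so a block of length 2k adjacent to a block of length 1 cannot support a separating inactive agent in this range of δ. -/

import Mathlib

open Matrix Finset Real

/-- Adjacency matrix of the path graph on `n` vertices:
`g i j = 1` iff `|i − j| = 1`. -/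
def pathAdj (n : ℕ) : Matrix (Fin n) (Fin n) ℝ :=
  Matrix.of fun i j => if (i : ℕ) + 1 = (j : ℕ) ∨ (j : ℕ) + 1 = (i : ℕ) then 1 else 0

/-- Multiplication by the path adjacency matrix, for a vector extended by zero at both ends. -/
lemma pathAdj_mulVec (n : ℕ) (f : ℕ → ℝ) (h0 : f 0 = 0) (hn : f (n + 1) = 0) (i : Fin n) :
    (pathAdj n *ᵥ fun j : Fin n => f (j + 1)) i = f i + f (i + 2) := by
  obtain ⟨i, hi⟩ := i
  have hsum : (pathAdj n *ᵥ fun j : Fin n => f (j + 1)) ⟨i, hi⟩ =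
      ∑ j ∈ range n, ((if i + 1 = j then f (j + 1) else 0) +
        (if j + 1 = i then f (j + 1) else 0)) := by
    rw [← Fin.sum_univ_eq_sum_range
      (fun j => (if i + 1 = j then f (j + 1) else 0) + (if j + 1 = i then f (j + 1) else 0))]
    simp only [mulVec, dotProduct, pathAdj, of_apply]
    refine Finset.sum_congr rfl fun j _ => ?_
    split_ifs <;> first | omega | simp
  rw [hsum, sum_add_distrib, Finset.sum_ite_eq, add_comm (f i)]
  congr 1
  · split_ifs with h
    · rfl
    · have : i + 2 = n + 1 := by simp at h; omega
      simp [this, hn]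
  · cases i with
    | zero => simp [h0]
    | succ i =>
      simp only [add_left_inj, Finset.sum_ite_eq']
      rw [if_pos (by simp; omega)]

lemma one_add_smul_pathAdj_mulVec (n : ℕ) (δ : ℝ) (f : ℕ → ℝ) (h0 : f 0 = 0)
    (hn : f (n + 1) = 0) (i : Fin n) :
    ((1 + δ • pathAdj n) *ᵥ fun j : Fin n => f (j + 1)) i = f (i + 1) + δ * (f i + f (i + 2)) := by
  rw [add_mulVec, one_mulVec, smul_mulVec, Pi.add_apply, Pi.smul_apply,
    pathAdj_mulVec n f h0 hn, smul_eq_mul]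

/-- `I + δG(n)` is invertible when `δ = 1 / (2 cos θ)` and `sin ((n + 1) θ) ≠ 0`. -/
lemma isUnit_det_one_add_smul_pathAdj (n : ℕ) (δ θ : ℝ) (hδ : 2 * δ * cos θ = 1)
    (hθ : sin θ ≠ 0) (hnθ : sin ((n + 1) * θ) ≠ 0) :
    IsUnit (1 + δ • pathAdj n).det := by
  rw [isUnit_iff_ne_zero]
  intro hdet
  obtain ⟨v, hv, hMv⟩ := exists_mulVec_eq_zero_iff.mpr hdet
  apply hv
  set f : ℕ → ℝ := fun j => if h : 1 ≤ j ∧ j ≤ n then v ⟨j - 1, by omega⟩ else 0 with hf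
  have hvf : v = fun j : Fin n => f (j + 1) := by
    funext j
    simp [hf]
  have h0 : f 0 = 0 := by simp [hf]
  have hn : f (n + 1) = 0 := by simp [hf]
  have hδ0 : δ ≠ 0 := by rintro rfl; simp at hδ
  have hrec (i : ℕ) (hi : i < n) : f (i + 2) = -(2 * cos θ) * f (i + 1) - f i := by
    have h := congrFun hMv ⟨i, hi⟩
    rw [hvf, one_add_smul_pathAdj_mulVec n δ f h0 hn] at h
    simp only [Pi.zero_apply] at h
    apply mul_left_cancel₀ hδ0
    linear_combination h + f (i + 1) * hδ
  have hsol (j : ℕ) : j ≤ n →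
      f j * sin θ = -(-1) ^ j * f 1 * sin (j * θ) ∧
        f (j + 1) * sin θ = (-1) ^ j * f 1 * sin ((j + 1) * θ) := by
    induction j with
    | zero => intro _; simp [h0]
    | succ j ih =>
      intro hj
      obtain ⟨h1, h2⟩ := ih (by omega)
      refine ⟨by push_cast; rw [h2]; ring, ?_⟩
      have hs : sin ((j + 1 + 1) * θ) = 2 * cos θ * sin ((j + 1) * θ) - sin (j * θ) := by
        rw [show ((j : ℝ) + 1 + 1) * θ = (j + 1) * θ + θ by ring,
          show (j : ℝ) * θ = (j + 1) * θ - θ by ring, sin_add, sin_sub]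
        ring
      push_cast
      rw [hrec j (by omega), hs]
      linear_combination -(2 * cos θ) * h2 - h1
  have hf1 : f 1 = 0 := by
    have h := (hsol n le_rfl).2
    rw [hn, zero_mul] at h
    simpa [hnθ] using h.symm
  rw [hvf]
  funext j
  have h := (hsol j j.2.le).2
  simpa [hf1, hθ] using h

/-- The endpoint activity of a path of even length `2k`, in terms of `θ` with
`δ = 1 / (2 cos θ)`. -/
lemma inv_mulVec_one_endpoint (k : ℕ) (hk : 0 < 2 * k) (δ θ : ℝ) (hδ : 2 * δ * cos θ = 1)
    (hc : 1 + cos θ ≠ 0) (hs : sin ((k + 1 / 2) * θ) ≠ 0)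
    (hdet : IsUnit (1 + δ • pathAdj (2 * k)).det) :
    ((1 + δ • pathAdj (2 * k))⁻¹ *ᵥ fun _ => 1) ⟨0, hk⟩ =
      cos θ / (1 + cos θ) * (1 + sin ((k + 1 / 2) * θ - θ) / sin ((k + 1 / 2) * θ)) := by
  set a := ((k : ℝ) + 1 / 2) * θ with ha
  set f : ℕ → ℝ := fun j => cos θ / (1 + cos θ) * (1 - (-1) ^ j * (sin (a - j * θ) / sin a))
    with hf
  have h0 : f 0 = 0 := by simp [hf, hs]
  have hn : f (2 * k + 1) = 0 := by
    have : a - ((2 * k + 1 : ℕ) : ℝ) * θ = -a := by rw [ha]; push_cast; ring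
    simp only [hf, this, sin_neg]
    simp [pow_succ, pow_mul, hs]
  have hsolve : ((1 + δ • pathAdj (2 * k)) *ᵥ fun j : Fin (2 * k) => f (j + 1)) = fun _ => 1 := by
    funext i
    rw [one_add_smul_pathAdj_mulVec _ _ f h0 hn]
    obtain ⟨i, hi⟩ := i
    simp only [hf]
    push_cast
    rw [show a - (i : ℝ) * θ = a - (i + 1) * θ + θ by ring,
      show a - ((i : ℝ) + 2) * θ = a - (i + 1) * θ - θ by ring,
      sin_add (a - (i + 1) * θ), sin_sub (a - (i + 1) * θ), pow_succ, pow_succ]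
    generalize a - ((i : ℝ) + 1) * θ = y
    field_simp
    linear_combination (sin a - (-1) ^ i * sin y * cos θ) * hδ
  rw [← hsolve, mulVec_mulVec, nonsing_inv_mul _ hdet, one_mulVec]
  simp [hf]

/-- for `δ ∈ (−1/(2cos((2m+2)π/(2m+3))), −1/(2cos(2mπ/(2m+1))))`
and `1 < k < m`, the matrix `I + δG(2k)` is invertible and the endpoint entry
`b(δ,2k)` of `(I + δG(2k))⁻¹𝟙` satisfies `δ·(b(δ,2k) + 1) < 1`, i.e.
`b(δ,1) + b(δ,2k) < 1/δ`. -/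
theorem endpoint_2k_plus_1_fails_separator
    (m : ℕ) (hm : 1 ≤ m) (δ : ℝ)
    (hδ : δ ∈ Set.Ioo (-1 / (2 * Real.cos ((2*m+2) * Real.pi / (2*m+3))))
                      (-1 / (2 * Real.cos ((2*m) * Real.pi / (2*m+1)))))
    (k : ℕ) (hk1 : 1 < k) (hkm : k < m) :
    IsUnit (1 + δ • pathAdj (2*k)).det ∧
    δ * (((1 + δ • pathAdj (2*k))⁻¹.mulVec (fun _ => 1)) ⟨0, by omega⟩ + 1) < 1 := by
  have hm0 : (0 : ℝ) ≤ m := m.cast_nonneg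
  have hkm' : (k : ℝ) + 1 ≤ m := by exact_mod_cast hkm
  have hk0 : (0 : ℝ) ≤ k := k.cast_nonneg
  have hpi := pi_pos
  obtain ⟨hlo, hhi⟩ := hδ
  rw [show (2 * (m : ℝ) + 2) * π / (2 * m + 3) = π - π / (2 * m + 3) by field_simp; ring,
    cos_pi_sub, mul_neg, neg_div_neg_eq] at hlo
  rw [show (2 * (m : ℝ)) * π / (2 * m + 1) = π - π / (2 * m + 1) by field_simp; ring,
    cos_pi_sub, mul_neg, neg_div_neg_eq] at hhi
  have hcos_pos (x : ℝ) (hx : 2 < x) : 0 < cos (π / x) := by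
    apply cos_pos_of_mem_Ioo
    have h1 : π / x < π / 2 := div_lt_div_of_pos_left hpi two_pos hx
    have h2 : 0 < π / x := by positivity
    constructor <;> linarith
  have hm1 : (1 : ℝ) ≤ m := by exact_mod_cast hm
  have hc3 := hcos_pos (2 * m + 3) (by linarith)
  have hc1 := hcos_pos (2 * m + 1) (by linarith)
  have hδ_half : 1 / 2 < δ := by
    refine lt_of_le_of_lt ?_ hlo
    apply one_div_le_one_div_of_le (by positivity)
    linarith [cos_le_one (π / (2 * (m : ℝ) + 3))]
  have hδ0 : 0 < δ := by linarith
  have hinv : 1 / (2 * δ) < 1 := by rw [div_lt_one] <;> linarith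
  have hinv0 : 0 < 1 / (2 * δ) := by positivity
  set θ := arccos (1 / (2 * δ)) with hθ
  have hcos : cos θ = 1 / (2 * δ) := cos_arccos (by linarith) hinv.le
  have hθ0 : 0 < θ := arccos_pos.mpr hinv
  have hθ_lt : θ < π / (2 * m + 1) := by
    by_contra! h
    have h' := cos_le_cos_of_nonneg_of_le_pi (by positivity) (arccos_le_pi _) h
    rw [← hθ, hcos] at h'
    rw [lt_div_iff₀ (by positivity)] at hhi
    rw [div_le_iff₀ (by positivity)] at h'
    linarith
  have hθm : θ * (2 * m + 1) < π := (lt_div_iff₀ (by positivity)).mp hθ_lt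
  have hθk : θ * (2 * k + 3) < π := by nlinarith
  have hkθ : 0 ≤ k * θ := by positivity
  have hδθ : 2 * δ * cos θ = 1 := by rw [hcos]; field_simp
  have hC : 0 < cos θ := by rw [hcos]; exact hinv0
  have hs : 0 < sin θ := sin_pos_of_pos_of_lt_pi hθ0 (by nlinarith)
  have hS : 0 < sin ((k + 1 / 2) * θ) := sin_pos_of_pos_of_lt_pi (by positivity) (by nlinarith)
  have hunit : IsUnit (1 + δ • pathAdj (2 * k)).det := by
    refine isUnit_det_one_add_smul_pathAdj _ δ θ hδθ hs.ne' (ne_of_gt ?_)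
    push_cast
    exact sin_pos_of_pos_of_lt_pi (by positivity) (by nlinarith)
  refine ⟨hunit, ?_⟩
  rw [inv_mulVec_one_endpoint k (by omega) δ θ hδθ (by positivity) hS.ne' hunit]
  have hcos_add : 0 < cos ((k + 1 / 2) * θ + θ) :=
    cos_pos_of_mem_Ioo ⟨by nlinarith, by nlinarith⟩
  rw [cos_add] at hcos_add
  rw [sin_sub, show δ = 1 / (2 * cos θ) by field_simp; linarith]
  set S := sin ((k + 1 / 2) * θ)
  set A := cos ((k + 1 / 2) * θ)
  have hsq := sin_sq_add_cos_sq θ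
  have key := mul_pos hs hcos_add
  rw [← sub_pos]
  have heq : 1 - 1 / (2 * cos θ) *
      (cos θ / (1 + cos θ) * (1 + (S * cos θ - A * sin θ) / S) + 1) =
      sin θ * (A * cos θ - S * sin θ) / (2 * cos θ * (1 + cos θ) * S) := by
    field_simp
    linear_combination S * hsq
  rw [heq]
  positivity
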